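/- (Completeness of Policy Descent Tree search, core of Theorem 1) Let M_R be a finite MDP, π* an optimal policy for M_R, and δ ∈ (0,1]. Let π_E be any policy satisfying the safety constraint ∀s, V^{π_E}_{M_R}(s) ≥ δ · V^{π*}_{M_R}(s). Then there exist n ≥ 0 and a finite sequence of policies π_0 = π*, π_1, …, π_n = π_E such that for each k < n: (i) π_{k+1} differs from π_k in exactly one state s_k and agrees with π_k elsewhere; (ii) the descent condition Q^{π_k}_{M_R}(s_k, π_{k+1}(s_k)) ≤ Q^{π_k}_{M_R}(s_k, π_k(s_k)) holds; and (iii) every intermediate policy dominates π_E in M_R, i.e., V^{π_k}_{M_R}(s) ≥ V^{π_E}_{M_R}(s) for all s (in particular every π_k satisfies the safety constraint). -/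

import Mathlib

open Finset

/-- A finite MDP with state space `S` and action space `A`:
transition probabilities `T`, rewards `R`, discount factor `γ ∈ [0,1)`. -/
structure MDP (S A : Type) [Fintype S] [Fintype A] where
  T : S → A → S → ℝ
  R : S → A → ℝ
  γ : ℝ
  T_nonneg : ∀ s a s', 0 ≤ T s a s'
  T_sum_one : ∀ s a, ∑ s' : S, T s a s' = 1
  γ_nonneg : 0 ≤ γ
  γ_lt_one : γ < 1

variable {S A : Type} [Fintype S] [Fintype A]

/-- `V` assigns to each stationary deterministic policy its value function,
i.e. a solution of the Bellman equations (unique since `γ < 1`). -/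
def IsValue (M : MDP S A) (V : (S → A) → S → ℝ) : Prop :=
  ∀ π : S → A, ∀ s : S, V π s = M.R s (π s) + M.γ * ∑ s' : S, M.T s (π s) s' * V π s'

/-- The Q-function `Q^π_M(s,a)` induced by the value function `V`. -/
def Qf (M : MDP S A) (V : (S → A) → S → ℝ) (π : S → A) (s : S) (a : A) : ℝ :=
  M.R s a + M.γ * ∑ s' : S, M.T s a s' * V π s'

/-- `πstar` is an optimal policy for `M`. -/
def IsOptimal (M : MDP S A) (V : (S → A) → S → ℝ) (πstar : S → A) : Prop :=
  ∀ π : S → A, ∀ s : S, V π s ≤ V πstar s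

/-- A function dominated by its own discounted one-step expectation is nonpositive. -/
theorem MDP.nonpos_of_le_discounted (M : MDP S A) (π : S → A) (D : S → ℝ)
    (h : ∀ s, D s ≤ M.γ * ∑ s' : S, M.T s (π s) s' * D s') (s : S) : D s ≤ 0 := by
  obtain ⟨m, -, hm⟩ := Finset.exists_max_image Finset.univ D ⟨s, Finset.mem_univ s⟩
  have hle : ∑ s' : S, M.T m (π m) s' * D s' ≤ D m := by
    calc ∑ s' : S, M.T m (π m) s' * D s' ≤ ∑ s' : S, M.T m (π m) s' * D m :=
          Finset.sum_le_sum fun s' hs' =>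
            mul_le_mul_of_nonneg_left (hm s' hs') (M.T_nonneg _ _ _)
      _ = D m := by rw [← Finset.sum_mul, M.T_sum_one, one_mul]
  have h1 := (h m).trans (mul_le_mul_of_nonneg_left hle M.γ_nonneg)
  have h2 := M.γ_lt_one
  have h3 : D m ≤ 0 := by nlinarith
  exact (hm s (Finset.mem_univ s)).trans h3

theorem Qf_sub_Qf (M : MDP S A) (V : (S → A) → S → ℝ) (π π' : S → A) (s : S) (a : A) :
    Qf M V π s a - Qf M V π' s a = M.γ * ∑ s' : S, M.T s a s' * (V π s' - V π' s') := by
  simp only [Qf, mul_sub, Finset.sum_sub_distrib]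
  ring

theorem Qf_congr (M : MDP S A) {V : (S → A) → S → ℝ} {π π' : S → A} (h : V π = V π')
    (s : S) (a : A) : Qf M V π s a = Qf M V π' s a := by
  simp only [Qf, h]

theorem IsValue.eq_Qf {M : MDP S A} {V : (S → A) → S → ℝ} (hV : IsValue M V)
    (π : S → A) (s : S) : V π s = Qf M V π s (π s) :=
  hV π s

/-- Policy improvement. -/
theorem IsValue.le_of_le_Qf {M : MDP S A} {V : (S → A) → S → ℝ} (hV : IsValue M V)
    {π π' : S → A} (h : ∀ s, V π s ≤ Qf M V π s (π' s)) : V π ≤ V π' := by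
  intro s
  refine sub_nonpos.1 (M.nonpos_of_le_discounted π' (fun s => V π s - V π' s) (fun s => ?_) s)
  have h1 := Qf_sub_Qf M V π π' s (π' s)
  linarith [h s, hV.eq_Qf π' s]

/-- Policy descent. -/
theorem IsValue.le_of_Qf_le {M : MDP S A} {V : (S → A) → S → ℝ} (hV : IsValue M V)
    {π π' : S → A} (h : ∀ s, Qf M V π s (π' s) ≤ V π s) : V π' ≤ V π := by
  intro s
  refine sub_nonpos.1 (M.nonpos_of_le_discounted π' (fun s => V π' s - V π s) (fun s => ?_) s)
  have h1 := Qf_sub_Qf M V π' π s (π' s)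
  linarith [h s, hV.eq_Qf π' s]

/-- A policy other than a given optimal one can adopt an optimal action, in a state where the two
differ, without loss. -/
theorem IsOptimal.exists_improvement {M : MDP S A} {V : (S → A) → S → ℝ} (hV : IsValue M V)
    {πstar : S → A} (hopt : IsOptimal M V πstar) {π : S → A} (hne : π ≠ πstar) :
    ∃ s, π s ≠ πstar s ∧ V π s ≤ Qf M V π s (πstar s) := by
  by_contra! hcon
  have hle : V πstar ≤ V π := hV.le_of_Qf_le fun s => by
    by_cases hs : π s = πstar s
    · rw [← hs, ← hV.eq_Qf]
    · exact (hcon s hs).le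
  have heq : V π = V πstar := le_antisymm (hopt π) hle
  obtain ⟨s, hs⟩ := Function.ne_iff.1 hne
  have h1 := hcon s hs
  rw [Qf_congr M heq, ← hV.eq_Qf, heq] at h1
  exact lt_irrefl _ h1

/-- Undoing an improvement in a single state is a descent step. -/
theorem IsValue.Qf_le_of_improvement {M : MDP S A} {V : (S → A) → S → ℝ} (hV : IsValue M V)
    {π π' : S → A} {s₀ : S} (hagree : ∀ s, s ≠ s₀ → π s = π' s) (hle : V π ≤ V π') :
    Qf M V π' s₀ (π s₀) ≤ Qf M V π' s₀ (π' s₀) := by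
  by_contra! hcon
  have hge : V π' ≤ V π := hV.le_of_le_Qf fun s => by
    rw [hV.eq_Qf π' s]
    by_cases hs : s = s₀
    · rw [hs]
      exact hcon.le
    · rw [hagree s hs]
  have heq : V π' = V π := le_antisymm hge hle
  rw [← hV.eq_Qf, Qf_congr M heq, ← hV.eq_Qf, heq] at hcon
  exact lt_irrefl _ hcon

open Classical in
theorem IsOptimal.exists_descent_path {M : MDP S A} {V : (S → A) → S → ℝ} (hV : IsValue M V)
    {πstar : S → A} (hopt : IsOptimal M V πstar) (n : ℕ) (π : S → A)
    (hn : #{s | π s ≠ πstar s} = n) :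
    ∃ πseq : ℕ → S → A,
      πseq 0 = πstar ∧ πseq n = π ∧
      (∀ k : ℕ, k < n → ∃ sk : S,
        πseq (k+1) sk ≠ πseq k sk ∧
        (∀ s : S, s ≠ sk → πseq (k+1) s = πseq k s) ∧
        Qf M V (πseq k) sk (πseq (k+1) sk) ≤ Qf M V (πseq k) sk (πseq k sk)) ∧
      (∀ k : ℕ, k ≤ n → ∀ s : S, V (πseq k) s ≥ V π s) := by
  induction n generalizing π with
  | zero =>
    have hπ : π = πstar := by
      funext s
      by_contra hs
      have hmem : s ∈ ({s | π s ≠ πstar s} : Finset S) := by simpa using hs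
      rw [Finset.card_eq_zero.1 hn] at hmem
      exact Finset.notMem_empty s hmem
    exact ⟨fun _ => π, hπ, rfl, fun k hk => absurd hk k.not_lt_zero, fun _ _ _ => le_rfl⟩
  | succ n ih =>
    have hne : π ≠ πstar := by
      rintro rfl
      simp at hn
    obtain ⟨s₀, hs₀, himp⟩ := hopt.exists_improvement hV hne
    set π' : S → A := Function.update π s₀ (πstar s₀) with hπ'
    have hself : π' s₀ = πstar s₀ := by simp [hπ']
    have hagree : ∀ s, s ≠ s₀ → π s = π' s := fun s hs => by simp [hπ', hs]
    have hle : V π ≤ V π' := hV.le_of_le_Qf fun s => by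
      by_cases hs : s = s₀
      · rw [hs, hself]
        exact himp
      · rw [← hagree s hs, ← hV.eq_Qf]
    have hcard : #{s | π' s ≠ πstar s} = n := by
      have herase : ({s | π' s ≠ πstar s} : Finset S)
          = ({s | π s ≠ πstar s} : Finset S).erase s₀ := by
        ext s
        by_cases hs : s = s₀
        · simp [hs, hself]
        · simp [hs, hagree s hs]
      rw [herase, Finset.card_erase_of_mem (by simpa using hs₀), hn, Nat.add_sub_cancel]
    obtain ⟨σ, h0, hend, hstep, hdom⟩ := ih π' hcard
    refine ⟨fun k => if k ≤ n then σ k else π, by simp [h0], by simp, fun k hk => ?_,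
      fun k _ s => ?_⟩
    · rcases Nat.lt_succ_iff_lt_or_eq.1 hk with hlt | rfl
      · simpa [hlt.le, Nat.succ_le_of_lt hlt] using hstep k hlt
      · refine ⟨s₀, ?_, ?_, ?_⟩
        · simpa [hend, hself] using hs₀
        · simpa [hend] using hagree
        · simpa [hend] using hV.Qf_le_of_improvement hagree hle
    · by_cases hk : k ≤ n
      · simpa [hk] using (hle s).trans (hdom k hk s)
      · simp [hk]

/-- completeness of Policy Descent Tree search: any safe policy `π_E` is
reachable from an optimal policy `π*` by a finite sequence of single-action policy
descent steps, all of whose intermediate policies dominate `π_E` in `M_R`. -/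
theorem pdt_completeness
    [Nonempty S] [Nonempty A]
    (MR : MDP S A) (V : (S → A) → S → ℝ) (hV : IsValue MR V)
    (πstar : S → A) (hopt : IsOptimal MR V πstar)
    (δ : ℝ) (hδ0 : 0 < δ) (hδ1 : δ ≤ 1)
    (πE : S → A) (hsafe : ∀ s : S, V πE s ≥ δ * V πstar s) :
    ∃ (n : ℕ) (πseq : ℕ → S → A),
      πseq 0 = πstar ∧ πseq n = πE ∧
      (∀ k : ℕ, k < n → ∃ sk : S,
        πseq (k+1) sk ≠ πseq k sk ∧
        (∀ s : S, s ≠ sk → πseq (k+1) s = πseq k s) ∧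
        Qf MR V (πseq k) sk (πseq (k+1) sk) ≤ Qf MR V (πseq k) sk (πseq k sk)) ∧
      (∀ k : ℕ, k ≤ n → ∀ s : S, V (πseq k) s ≥ V πE s) := by
  classical
  exact ⟨_, hopt.exists_descent_path hV _ πE rfl⟩
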